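/- For every α ∈ (0,1], m > 0 and x ≥ 0, one has E_{α,m,m−1/α}(−x) ≤ (1 + (Γ(1 + αm)/Γ(1 + α(m+1))) x)^{−(1 + 1/m)}. -/

import Mathlib

/-- The Kilbas-Saigo function `E_{α,m,l}(x)` for real argument. -/
noncomputable def kilbasSaigo (α m l : ℝ) (x : ℝ) : ℝ :=
  ∑' n : ℕ, (∏ k ∈ Finset.range n,
    Real.Gamma (1 + α * (k * m + l)) / Real.Gamma (1 + α * (k * m + l + 1))) * x ^ n

open MeasureTheory Set Filter Topology

lemma ks_beta (p q : ℝ) (hp : 0 < p) (hq : 0 < q) :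
    IntegrableOn (fun v : ℝ => v ^ (p - 1) * (1 - v) ^ (q - 1)) (Ioc 0 1) ∧
    ∫ v in Ioc (0:ℝ) 1, v ^ (p - 1) * (1 - v) ^ (q - 1) =
      Real.Gamma p * Real.Gamma q / Real.Gamma (p + q) := by
  have h := Complex.betaIntegral_convergent (u := (p:ℂ)) (v := (q:ℂ)) (by simpa) (by simpa)
  rw [intervalIntegrable_iff_integrableOn_Ioc_of_le zero_le_one] at h
  have e : ∀ v ∈ Ioc (0:ℝ) 1, ((v : ℂ) ^ ((p:ℂ) - 1) * (1 - (v : ℂ)) ^ ((q:ℂ) - 1)).re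
      = v ^ (p - 1) * (1 - v) ^ (q - 1) := by
    intro v hv
    norm_cast
    rw [← Complex.ofReal_cpow hv.1.le, ← Complex.ofReal_cpow (by linarith [hv.2])]
    norm_cast
  have hre := h.re
  refine ⟨IntegrableOn.congr_fun hre e measurableSet_Ioc, ?_⟩
  have := ProbabilityTheory.beta_eq_betaIntegralReal p q hp hq
  rw [ProbabilityTheory.beta, Complex.betaIntegral,
    intervalIntegral.integral_of_le zero_le_one] at this
  rw [this, ← RCLike.re_to_complex, ← integral_re h]
  exact (setIntegral_congr_fun measurableSet_Ioc e).symm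

lemma ks_cont (α : ℝ) (hα : 0 < α) (hα1 : α < 1) (b : ℝ → ℝ) (hb : ContinuousOn b (Ici 0))
    (hd : DifferentiableAt ℝ b 1) (hb1 : b 1 = 0) :
    ContinuousOn (fun v : ℝ => v ^ α * (1 - v) ^ (-α) * b v) (Icc 0 1) := by
  have h1 : ContinuousOn (dslope b 1) (Ici 0) :=
    (continuousOn_dslope (Ici_mem_nhds zero_lt_one)).2 ⟨hb, hd⟩
  have h2 : ContinuousOn (fun v : ℝ => -(v ^ α * (1 - v) ^ (1 - α) * dslope b 1 v)) (Icc 0 1) := by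
    refine ContinuousOn.neg (ContinuousOn.mul (Continuous.continuousOn ?_) (h1.mono Icc_subset_Ici_self))
    exact (Real.continuous_rpow_const hα.le).mul
      ((Real.continuous_rpow_const (by linarith)).comp (by fun_prop))
  refine h2.congr ?_
  intro v hv
  rcases hv.2.eq_or_lt with rfl | hlt
  · simp [hb1, Real.zero_rpow (show (1:ℝ) - α ≠ 0 by linarith)]
  · have h3 : (1 - v) ^ (1 - α) = (1 - v) * (1 - v) ^ (-α) := by
      rw [sub_eq_add_neg 1 α, Real.rpow_add (by linarith), Real.rpow_one]
    simp only
    rw [dslope_of_ne _ hlt.ne, slope_def_field, hb1, h3]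
    have : v - 1 ≠ 0 := by linarith
    field_simp
    ring

lemma ks_deriv (α : ℝ) (b : ℝ → ℝ) (b' v : ℝ) (hv : v ∈ Ioo (0:ℝ) 1) (hb : HasDerivAt b b' v) :
    HasDerivAt (fun v : ℝ => v ^ α * (1 - v) ^ (-α) * b v)
      (v ^ (α - 1) * (1 - v) ^ (-α - 1) * (α * b v + v * (1 - v) * b')) v := by
  have h0 : 0 < v := hv.1
  have h1 : 0 < 1 - v := by linarith [hv.2]
  have d1 : HasDerivAt (fun v : ℝ => v ^ α) (α * v ^ (α - 1)) v :=
    Real.hasDerivAt_rpow_const (Or.inl h0.ne')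
  have d2 : HasDerivAt (fun v : ℝ => (1 - v) ^ (-α)) ((-1) * (-α) * (1 - v) ^ (-α - 1)) v :=
    ((hasDerivAt_id v).const_sub 1).rpow_const (Or.inl h1.ne')
  refine ((d1.mul d2).mul hb).congr_deriv ?_
  have e1 : v ^ α = v ^ (α - 1) * v := by
    rw [Real.rpow_sub_one h0.ne']; field_simp
  have e2 : (1 - v) ^ (-α) = (1 - v) ^ (-α - 1) * (1 - v) := by
    rw [Real.rpow_sub_one h1.ne']; field_simp
  simp only [Pi.mul_apply]
  rw [e1, e2]
  ring

lemma ks_bern (q v : ℝ) (hq : 0 ≤ q) (hv : v ∈ Ioc (0:ℝ) 1) :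
    1 - v ^ q ≤ (q + 1) * (1 - v) := by
  rcases le_total 1 q with h | h
  · have := one_add_mul_self_le_rpow_one_add (s := v - 1) (by linarith [hv.1]) h
    rw [add_sub_cancel] at this
    nlinarith [hv.2]
  · have := Real.rpow_le_rpow_of_exponent_ge hv.1 hv.2 h
    rw [Real.rpow_one] at this
    nlinarith [hv.2, mul_nonneg hq (sub_nonneg.2 hv.2)]

lemma ks_phi (α q : ℝ) (hα : 0 < α) (hα1 : α < 1) (hq : 0 < q) :
    IntegrableOn (fun v : ℝ => (1 - v ^ q) * (v ^ (α - 1) * (1 - v) ^ (-α - 1))) (Ioc 0 1) ∧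
    ∫ v in Ioc (0:ℝ) 1, (1 - v ^ q) * (v ^ (α - 1) * (1 - v) ^ (-α - 1)) =
      Real.Gamma (1 - α) / α * (Real.Gamma (q + α) / Real.Gamma q) := by
  obtain ⟨i1, -⟩ := ks_beta α (1 - α) hα (by linarith)
  obtain ⟨i2, v2⟩ := ks_beta (q + α) (1 - α) (by linarith) (by linarith)
  have hint : IntegrableOn (fun v : ℝ => (1 - v ^ q) * (v ^ (α - 1) * (1 - v) ^ (-α - 1)))
      (Ioc 0 1) := by
    refine Integrable.mono' (i1.const_mul (q + 1)) (by fun_prop) ?_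
    refine (ae_restrict_iff' measurableSet_Ioc).2 (ae_of_all _ ?_)
    intro v hv
    have hb := ks_bern q v hq.le hv
    have h1 : v ^ q ≤ 1 := Real.rpow_le_one hv.1.le hv.2 hq.le
    have h0 : 0 ≤ 1 - v := by linarith [hv.2]
    rw [Real.norm_of_nonneg (mul_nonneg (by linarith) (mul_nonneg (Real.rpow_nonneg hv.1.le _) (Real.rpow_nonneg h0 _)))]
    rcases h0.eq_or_lt with h | h
    · have : v = 1 := by linarith
      subst this
      simp
      positivity
    · have e2 : (1 - v) ^ (1 - α - 1) = (1 - v) ^ (-α - 1) * (1 - v) := by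
        rw [Real.rpow_sub_one h.ne' (-α), show 1 - α - 1 = -α by ring]; field_simp
      rw [e2]
      calc _ ≤ ((q + 1) * (1 - v)) * (v ^ (α - 1) * (1 - v) ^ (-α - 1)) := by
            gcongr
            exact mul_nonneg (Real.rpow_nonneg hv.1.le _) (Real.rpow_nonneg h0 _)
        _ = _ := by ring
  refine ⟨hint, ?_⟩
  have hdf : ∀ v : ℝ, 0 < v → HasDerivAt (fun v : ℝ => 1 - v ^ q) (-(q * v ^ (q - 1))) v :=
    fun v hv => (Real.hasDerivAt_rpow_const (Or.inl hv.ne')).const_sub 1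
  have hc := ks_cont α hα hα1 (fun v => 1 - v ^ q)
    (continuous_const.sub (Real.continuous_rpow_const hq.le)).continuousOn
    (hdf 1 one_pos).differentiableAt (by simp)
  have hI : IntervalIntegrable (fun v : ℝ => α * ((1 - v ^ q) * (v ^ (α - 1) * (1 - v) ^ (-α - 1)))
      - q * (v ^ (q + α - 1) * (1 - v) ^ (1 - α - 1))) volume 0 1 :=
    (intervalIntegrable_iff_integrableOn_Ioc_of_le zero_le_one).2
      ((hint.const_mul α).sub (i2.const_mul q))
  have key := intervalIntegral.integral_eq_sub_of_hasDerivAt_of_le zero_le_one hc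
    (f' := fun v : ℝ => α * ((1 - v ^ q) * (v ^ (α - 1) * (1 - v) ^ (-α - 1)))
      - q * (v ^ (q + α - 1) * (1 - v) ^ (1 - α - 1))) ?_ hI
  · rw [intervalIntegral.integral_of_le zero_le_one,
      integral_sub (hint.const_mul α) (i2.const_mul q), integral_const_mul, integral_const_mul, v2] at key
    simp [Real.zero_rpow hα.ne'] at key
    have hg : Real.Gamma (q + 1) = q * Real.Gamma q := Real.Gamma_add_one hq.ne'
    have hgp := Real.Gamma_pos_of_pos hq
    rw [hg] at key
    field_simp at key ⊢
    linarith
  · intro v hv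
    refine (ks_deriv α _ _ v hv (hdf v hv.1)).congr_deriv ?_
    have h1 : 0 < 1 - v := by linarith [hv.2]
    have e2 : (1 - v) ^ (1 - α - 1) = (1 - v) ^ (-α - 1) * (1 - v) := by
      rw [Real.rpow_sub_one h1.ne' (-α), show 1 - α - 1 = -α by ring]; field_simp
    have e3 : v ^ (q + α - 1) = v ^ (α - 1) * v * v ^ (q - 1) := by
      rw [← Real.rpow_add_one hv.1.ne', ← Real.rpow_add hv.1]; ring_nf
    rw [e2, e3]
    ring

lemma ks_integrable_tsum {μ : Measure ℝ} {F : ℕ → ℝ → ℝ} (hF : ∀ i, Integrable (F i) μ)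
    (hs : Summable fun i => ∫ v, ‖F i v‖ ∂μ)
    (hm : AEStronglyMeasurable (fun v => ∑' i, F i v) μ) :
    Integrable (fun v => ∑' i, F i v) μ := by
  refine ⟨hm, ?_⟩
  have h1 : ∫⁻ v, ‖∑' i, F i v‖ₑ ∂μ ≤ ∑' i, ∫⁻ v, ‖F i v‖ₑ ∂μ := by
    rw [← lintegral_tsum (fun i => (hF i).1.enorm)]
    exact lintegral_mono fun v => enorm_tsum_le_tsum_enorm
  refine lt_of_le_of_lt h1 ?_
  have h2 : ∀ i, ∫⁻ v, ‖F i v‖ₑ ∂μ = ENNReal.ofReal (∫ v, ‖F i v‖ ∂μ) := fun i =>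
    (ofReal_integral_norm_eq_lintegral_enorm (hF i)).symm
  simp_rw [h2]
  rw [← ENNReal.ofReal_tsum_of_nonneg (fun i => integral_nonneg fun v => norm_nonneg _) hs]
  exact ENNReal.ofReal_lt_top

noncomputable def ksC (α a : ℝ) (n : ℕ) : ℝ :=
  ∏ k ∈ Finset.range n, Real.Gamma (a * (k + 1)) / Real.Gamma (a * (k + 1) + α)

lemma ksC_pos (α a : ℝ) (hα : 0 < α) (ha : 0 < a) (n : ℕ) : 0 < ksC α a n := by
  refine Finset.prod_pos fun k _ => div_pos (Real.Gamma_pos_of_pos ?_) (Real.Gamma_pos_of_pos ?_) <;>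
    positivity

lemma ks_summable (α a x X : ℝ) (hα : 0 < α) (ha : 0 < a) (hX : 0 ≤ X) (hXx : X ≤ x)
    (hs : Summable fun n => ksC α a n * x ^ n) : Summable fun n => ksC α a n * X ^ n := by
  refine Summable.of_nonneg_of_le (fun n => ?_) (fun n => ?_) hs
  · exact mul_nonneg (ksC_pos α a hα ha n).le (by positivity)
  · have := (ksC_pos α a hα ha n).le
    gcongr

lemma ks_summable' (α a x X : ℝ) (hα : 0 < α) (ha : 0 < a) (hX : 0 ≤ X) (hXx : X ≤ x)
    (hs : Summable fun n => ksC α a n * x ^ n) : Summable fun n => ksC α a n * (-X) ^ n := by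
  refine Summable.of_norm ?_
  have h := ks_summable α a x X hα ha hX hXx hs
  refine h.congr fun n => ?_
  rw [norm_mul, norm_pow, norm_neg, Real.norm_of_nonneg hX,
    Real.norm_of_nonneg (ksC_pos α a hα ha n).le]

lemma ks_contY (α a x : ℝ) (hα : 0 < α) (ha : 0 < a)
    (hs : Summable fun n => ksC α a n * x ^ n) :
    ContinuousOn (fun X => ∑' n, ksC α a n * (-X) ^ n) (Icc 0 x) := by
  refine continuousOn_tsum (fun n => by fun_prop) hs ?_
  intro n X hX
  rw [norm_mul, norm_pow, norm_neg, Real.norm_of_nonneg hX.1,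
    Real.norm_of_nonneg (ksC_pos α a hα ha n).le]
  have := (ksC_pos α a hα ha n).le
  have := hX.1
  have := hX.2
  gcongr

lemma ks_Y (α a X : ℝ) (hα : 0 < α) (hα1 : α < 1) (ha : 0 < a) (hX : 0 ≤ X)
    (hs : Summable fun n => ksC α a n * X ^ n) :
    IntegrableOn (fun v : ℝ => ((∑' n, ksC α a n * (-X) ^ n) - ∑' n, ksC α a n * (-(X * v ^ a)) ^ n)
      * (v ^ (α - 1) * (1 - v) ^ (-α - 1))) (Ioc 0 1) ∧
    ∫ v in Ioc (0:ℝ) 1, ((∑' n, ksC α a n * (-X) ^ n) - ∑' n, ksC α a n * (-(X * v ^ a)) ^ n)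
      * (v ^ (α - 1) * (1 - v) ^ (-α - 1)) =
      Real.Gamma (1 - α) / α * (-X * ∑' n, ksC α a n * (-X) ^ n) := by
  set F : ℕ → ℝ → ℝ := fun n v => ksC α a n * (-X) ^ n *
    ((1 - v ^ (a * n)) * (v ^ (α - 1) * (1 - v) ^ (-α - 1))) with hF
  have hF0 : F 0 = 0 := by ext v; simp [hF]
  have hstep : ∀ n : ℕ, ksC α a (n + 1) * (Real.Gamma (a * (n + 1) + α) / Real.Gamma (a * (n + 1)))
      = ksC α a n := by
    intro n
    have h1 := Real.Gamma_pos_of_pos (show 0 < a * ((n:ℝ) + 1) by positivity)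
    have h2 := Real.Gamma_pos_of_pos (show 0 < a * ((n:ℝ) + 1) + α by positivity)
    rw [ksC, Finset.prod_range_succ, ← ksC]
    field_simp
  have hphi := fun n : ℕ => ks_phi α (a * (n + 1)) hα hα1 (by positivity)
  have hFi : ∀ n, Integrable (F n) (volume.restrict (Ioc 0 1)) := by
    intro n
    cases n with
    | zero => rw [hF0]; exact integrable_zero _ _ _
    | succ n => simpa [hF] using (hphi n).1.const_mul (ksC α a (n+1) * (-X) ^ (n+1))
  have hFv : ∀ n, ∫ v in Ioc (0:ℝ) 1, F (n + 1) v =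
      Real.Gamma (1 - α) / α * (-X * (ksC α a n * (-X) ^ n)) := by
    intro n
    simp only [hF]
    push_cast
    rw [integral_const_mul, (hphi n).2, ← hstep n]
    ring
  have hFn : ∀ n, ∫ v in Ioc (0:ℝ) 1, ‖F (n + 1) v‖ =
      Real.Gamma (1 - α) / α * (X * (ksC α a n * X ^ n)) := by
    intro n
    have : ∀ v ∈ Ioc (0:ℝ) 1, ‖F (n + 1) v‖ = ksC α a (n+1) * X ^ (n+1) *
        ((1 - v ^ (a * ((n:ℝ) + 1))) * (v ^ (α - 1) * (1 - v) ^ (-α - 1))) := by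
      intro v hv
      simp only [hF]
      push_cast
      have h1 : v ^ (a * ((n:ℝ) + 1)) ≤ 1 := Real.rpow_le_one hv.1.le hv.2 (by positivity)
      rw [norm_mul, norm_mul, norm_pow, norm_neg, Real.norm_of_nonneg hX,
        Real.norm_of_nonneg (ksC_pos α a hα ha _).le, Real.norm_of_nonneg]
      exact mul_nonneg (by linarith) (mul_nonneg (Real.rpow_nonneg hv.1.le _)
        (Real.rpow_nonneg (by linarith [hv.2]) _))
    rw [setIntegral_congr_fun measurableSet_Ioc this, integral_const_mul, (hphi n).2, ← hstep n]
    ring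
  have hsum : Summable fun n => ∫ v in Ioc (0:ℝ) 1, ‖F n v‖ := by
    rw [← summable_nat_add_iff 1]
    simp_rw [hFn]
    exact (hs.mul_left X).mul_left _
  have hpt : ∀ v ∈ Ioc (0:ℝ) 1, ∑' n, F n v =
      ((∑' n, ksC α a n * (-X) ^ n) - ∑' n, ksC α a n * (-(X * v ^ a)) ^ n)
      * (v ^ (α - 1) * (1 - v) ^ (-α - 1)) := by
    intro v hv
    have h0 : 0 ≤ v ^ a := Real.rpow_nonneg hv.1.le _
    have h1 : v ^ a ≤ 1 := Real.rpow_le_one hv.1.le hv.2 ha.le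
    rw [← Summable.tsum_sub (ks_summable' α a X X hα ha hX le_rfl hs)
      (ks_summable' α a X (X * v ^ a) hα ha (by positivity) (by nlinarith) hs), ← tsum_mul_right]
    refine tsum_congr fun n => ?_
    simp only [hF]
    rw [Real.rpow_mul_natCast hv.1.le, ← neg_mul, mul_pow]
    ring
  have hmeas : AEStronglyMeasurable (fun v => ∑' n, F n v) (volume.restrict (Ioc 0 1)) := by
    have hc : ContinuousOn (fun v : ℝ => ((∑' n, ksC α a n * (-X) ^ n)
        - ∑' n, ksC α a n * (-(X * v ^ a)) ^ n)) (Ioc 0 1) := by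
      refine continuousOn_const.sub ?_
      refine (ks_contY α a X hα ha hs).comp (f := fun v : ℝ => X * v ^ a)
        (continuous_const.mul (Real.continuous_rpow_const ha.le)).continuousOn ?_
      intro v hv
      have h0 : 0 ≤ v ^ a := Real.rpow_nonneg hv.1.le _
      have h1 : v ^ a ≤ 1 := Real.rpow_le_one hv.1.le hv.2 ha.le
      exact ⟨by positivity, by nlinarith⟩
    have h2 := (hc.aestronglyMeasurable (μ := volume) measurableSet_Ioc).mul
      (show AEStronglyMeasurable (fun v : ℝ => v ^ (α - 1) * (1 - v) ^ (-α - 1))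
        (volume.restrict (Ioc 0 1)) by fun_prop)
    refine h2.congr ?_
    refine (ae_restrict_iff' measurableSet_Ioc).2 (ae_of_all _ fun v hv => ?_)
    exact (hpt v hv).symm
  have hI := ks_integrable_tsum hFi hsum hmeas
  refine ⟨IntegrableOn.congr_fun hI hpt measurableSet_Ioc, ?_⟩
  rw [← setIntegral_congr_fun measurableSet_Ioc hpt]
  have hS := hasSum_integral_of_summable_integral_norm hFi hsum
  rw [← hS.tsum_eq, hS.summable.tsum_eq_zero_add, hF0]
  simp_rw [hFv]
  rw [tsum_mul_left, tsum_mul_left]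
  simp

lemma ks_main (α m x : ℝ) (hα : 0 < α) (hα1 : α < 1) (hm : 0 < m) (hx : 0 ≤ x)
    (hs : Summable fun n => ksC α (α * m) n * x ^ n) :
    ∑' n, ksC α (α * m) n * (-x) ^ n ≤
      (1 + Real.Gamma (1 + α * m) / Real.Gamma (1 + α * (m + 1)) * x) ^ (-(1 + 1 / m)) := by
  set a := α * m with hadef
  have ha : 0 < a := by positivity
  set C := Real.Gamma (1 + a) / Real.Gamma (1 + α * (m + 1)) with hC
  have hg1 := Real.Gamma_pos_of_pos (show 0 < 1 + a by positivity)
  have hg2 := Real.Gamma_pos_of_pos (show 0 < 1 + α * (m + 1) by positivity)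
  have hg3 := Real.Gamma_pos_of_pos (show 0 < 1 - α by linarith)
  have hCpos : 0 < C := by positivity
  set y : ℝ → ℝ := fun X => ∑' n, ksC α a n * (-X) ^ n with hy
  set z : ℝ → ℝ := fun X => (1 + C * X) ^ (-(1 + 1 / m)) with hz
  have hzc : ContinuousOn z (Icc 0 x) := by
    refine ContinuousOn.rpow_const (by fun_prop) fun X hX => Or.inl ?_
    have := mul_nonneg hCpos.le hX.1
    positivity
  have hyc : ContinuousOn y (Icc 0 x) := ks_contY α a x hα ha hs
  obtain ⟨X, hX, hmin⟩ := isCompact_Icc.exists_isMinOn (nonempty_Icc.2 hx) (hzc.sub hyc)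
  suffices h : 0 ≤ z X - y X by
    have h2 : z X - y X ≤ z x - y x := hmin (right_mem_Icc.2 hx)
    change y x ≤ z x
    linarith
  have hX0 : 0 ≤ X := hX.1
  rcases hX0.eq_or_lt with h0 | hXpos
  · rw [← h0]
    simp only [hz, hy]
    rw [tsum_eq_single 0 (by intro n hn; simp [hn])]
    simp [ksC]
  -- main case
  obtain ⟨yI, yV⟩ := ks_Y α a X hα hα1 ha hX0 (ks_summable α a x X hα ha hX0 hX.2 hs)
  obtain ⟨pI, pV⟩ := ks_phi α (a + 1) hα hα1 (by positivity)
  set Y := C * X with hYdef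
  have hY : 0 < Y := by positivity
  have hbase : ∀ v : ℝ, 0 ≤ v → 0 < 1 + Y * v ^ a := fun v hv => by
    have := Real.rpow_nonneg hv a
    positivity
  set b : ℝ → ℝ := fun v => (1 + Y) ^ (-(1 / m)) - (1 + Y * v ^ a) ^ (-(1 / m)) with hb
  have hbd : ∀ v : ℝ, 0 < v → HasDerivAt b
      (α * Y * v ^ (a - 1) * (1 + Y * v ^ a) ^ (-(1 + 1 / m))) v := by
    intro v hv
    have h1 : HasDerivAt (fun v : ℝ => 1 + Y * v ^ a) (Y * (a * v ^ (a - 1))) v :=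
      ((Real.hasDerivAt_rpow_const (Or.inl hv.ne')).const_mul Y).const_add 1
    have h2 := (h1.rpow_const (p := -(1 / m)) (Or.inl (hbase v hv.le).ne')).const_sub
      ((1 + Y) ^ (-(1 / m)))
    refine h2.congr_deriv ?_
    rw [show -(1 / m) - 1 = -(1 + 1 / m) by ring, hadef]
    field_simp
  have hbc : ContinuousOn b (Ici 0) := by
    refine continuousOn_const.sub (ContinuousOn.rpow_const ?_ fun v hv => Or.inl (hbase v hv).ne')
    exact (continuous_const.add (continuous_const.mul
      (Real.continuous_rpow_const ha.le))).continuousOn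
  have hcont := ks_cont α hα hα1 b hbc (hbd 1 one_pos).differentiableAt (by simp [hb])
  have hIφ := (yI.const_mul α).add (pI.const_mul (α * (Y * z X)))
  have key := intervalIntegral.sub_le_integral_of_hasDeriv_right_of_le zero_le_one hcont
    (fun v hv => (ks_deriv α b _ v hv (hbd v hv.1)).hasDerivWithinAt)
    ((integrableOn_Icc_iff_integrableOn_Ioc).2 hIφ) ?_
  · simp only [Pi.add_apply] at key
    rw [intervalIntegral.integral_of_le zero_le_one,
      integral_add (yI.const_mul α) (pI.const_mul (α * (Y * z X))), integral_const_mul,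
      integral_const_mul, yV, pV] at key
    simp only [hb, Real.zero_rpow hα.ne', Real.one_rpow, mul_one, sub_self, mul_zero, zero_mul] at key
    have e : Real.Gamma (a + 1 + α) / Real.Gamma (a + 1) = 1 / C := by
      rw [hC, one_div_div, add_comm a 1]
      congr 2
      rw [hadef]; ring
    rw [e, hYdef] at key
    change 0 ≤ α * (Real.Gamma (1 - α) / α * (-X * y X)) +
      α * (C * X * z X) * (Real.Gamma (1 - α) / α * (1 / C)) at key
    have e2 : α * (Real.Gamma (1 - α) / α * (-X * y X)) +
      α * (C * X * z X) * (Real.Gamma (1 - α) / α * (1 / C)) =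
      (Real.Gamma (1 - α) * X) * (z X - y X) := by
      field_simp
      ring
    rw [e2] at key
    exact nonneg_of_mul_nonneg_right key (by positivity)
  · intro v hv
    have hv0 := hv.1
    have hv1 := hv.2
    have hJ : 0 ≤ v ^ (α - 1) * (1 - v) ^ (-α - 1) :=
      mul_nonneg (Real.rpow_nonneg hv0.le _) (Real.rpow_nonneg (by linarith) _)
    have h0 : 0 < v ^ a := Real.rpow_pos_of_pos hv0 _
    have h1 : v ^ a ≤ 1 := Real.rpow_le_one hv0.le hv1.le ha.le
    have hmn : z X - y X ≤ z (X * v ^ a) - y (X * v ^ a) :=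
      hmin ⟨by positivity, by nlinarith [hX.2]⟩
    have hzv : z (X * v ^ a) = (1 + Y * v ^ a) ^ (-(1 + 1 / m)) := by
      simp only [hz, hYdef, mul_assoc]
    have hzX : z X = (1 + Y) ^ (-(1 + 1 / m)) := rfl
    have hmono : z X ≤ z (X * v ^ a) := by
      rw [hzv, hzX]
      refine Real.rpow_le_rpow_of_nonpos (hbase v hv0.le) (by nlinarith) ?_
      have : 0 < 1 / m := by positivity
      linarith
    have ep : ∀ t : ℝ, 0 < t → t ^ (-(1 / m)) = t * t ^ (-(1 + 1 / m)) := by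
      intro t ht
      rw [show -(1 / m) = -(1 + 1 / m) + 1 by ring, Real.rpow_add_one ht.ne']
      ring
    have hbv : b v = (1 + Y) * z X - (1 + Y * v ^ a) * z (X * v ^ a) := by
      simp only [hb]
      rw [ep _ (by positivity), ep _ (hbase v hv0.le), hzv, hzX]
    have e1 : v ^ (a + 1) = v ^ a * v := Real.rpow_add_one hv0.ne' _
    have e3 : v * v ^ (a - 1) = v ^ a := by
      rw [Real.rpow_sub_one hv0.ne']; field_simp
    simp only [Pi.add_apply]
    change _ ≤ α * ((y X - y (X * v ^ a)) * (v ^ (α - 1) * (1 - v) ^ (-α - 1))) + _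
    rw [← hzv, hbv, e1]
    have hineq : (1 + Y) * z X - (1 + Y * v ^ a) * z (X * v ^ a) +
        (1 - v) * (Y * v ^ a * z (X * v ^ a)) ≤
        (y X - y (X * v ^ a)) + Y * z X * (1 - v ^ a * v) := by
      have := mul_nonneg (mul_nonneg hY.le (mul_nonneg h0.le hv0.le)) (sub_nonneg.2 hmono)
      nlinarith
    have := mul_le_mul_of_nonneg_left hineq (mul_nonneg hα.le hJ)
    calc _ = α * (v ^ (α - 1) * (1 - v) ^ (-α - 1)) * ((1 + Y) * z X - (1 + Y * v ^ a) * z (X * v ^ a) +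
        (1 - v) * (Y * (v * v ^ (a - 1)) * z (X * v ^ a))) := by ring
      _ ≤ α * (v ^ (α - 1) * (1 - v) ^ (-α - 1)) *
          (y X - y (X * v ^ a) + Y * z X * (1 - v ^ a * v)) := by rw [e3]; exact this
      _ = _ := by ring

theorem kilbasSaigo_frechet_upper_bound (α m x : ℝ)
    (hα : α ∈ Set.Ioc (0 : ℝ) 1) (hm : 0 < m) (hx : 0 ≤ x) :
    kilbasSaigo α m (m - 1 / α) (-x) ≤
      (1 + Real.Gamma (1 + α * m) / Real.Gamma (1 + α * (m + 1)) * x) ^ (-(1 + 1 / m)) := by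
  obtain ⟨h0, h1⟩ := hα
  have e : kilbasSaigo α m (m - 1 / α) (-x) = ∑' n, ksC α (α * m) n * (-x) ^ n := by
    refine tsum_congr fun n => ?_
    congr 1
    refine Finset.prod_congr rfl fun k _ => ?_
    congr 2 <;> (field_simp; ring)
  rw [e]
  have hg1 := Real.Gamma_pos_of_pos (show 0 < 1 + α * m by positivity)
  have hg2 := Real.Gamma_pos_of_pos (show 0 < 1 + α * (m + 1) by positivity)
  rcases h1.eq_or_lt with rfl | hlt
  · have hc : ∀ n : ℕ, ksC 1 (1 * m) n * (-x) ^ n = (-x / m) ^ n / n.factorial := by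
      intro n
      have : ksC 1 (1 * m) n = (1 / m) ^ n / n.factorial := by
        induction n with
        | zero => simp [ksC]
        | succ n ih =>
          have hp : 0 < 1 * m * ((n:ℝ) + 1) := by positivity
          have := Real.Gamma_pos_of_pos hp
          rw [ksC, Finset.prod_range_succ, ← ksC, ih, Real.Gamma_add_one hp.ne',
            Nat.factorial_succ]
          push_cast
          rw [pow_succ]
          field_simp
      rw [this, div_pow, div_pow]
      ring
    simp_rw [hc]
    have hexp : ∑' n : ℕ, (-x / m) ^ n / (n.factorial : ℝ) = Real.exp (-x / m) := by
      rw [Real.exp_eq_exp_ℝ, NormedSpace.exp_eq_tsum_div]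
    rw [hexp]
    have hG : Real.Gamma (1 + 1 * m) / Real.Gamma (1 + 1 * (m + 1)) = 1 / (m + 1) := by
      rw [show 1 + 1 * (m + 1) = (m + 1) + 1 by ring, Real.Gamma_add_one (by positivity),
        show 1 + 1 * m = m + 1 by ring]
      rw [show 1 + 1 * m = m + 1 by ring] at hg1
      field_simp
    rw [hG]
    have hb : 0 < 1 + 1 / (m + 1) * x := by positivity
    rw [Real.rpow_def_of_pos hb, Real.exp_le_exp]
    have hl := Real.log_le_sub_one_of_pos hb
    have : Real.log (1 + 1 / (m + 1) * x) * (1 + 1 / m) ≤ (1 / (m + 1) * x) * (1 + 1 / m) := by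
      gcongr
      linarith
    have e2 : (1 / (m + 1) * x) * (1 + 1 / m) = x / m := by field_simp
    rw [e2] at this
    rw [neg_div]
    linarith
  · by_cases hs : Summable fun n => ksC α (α * m) n * (-x) ^ n
    · refine ks_main α m x h0 hlt hm hx ?_
      refine hs.norm.congr fun n => ?_
      rw [norm_mul, norm_pow, norm_neg, Real.norm_of_nonneg hx,
        Real.norm_of_nonneg (ksC_pos α _ h0 (by positivity) n).le]
    · rw [tsum_eq_zero_of_not_summable hs]
      positivity
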